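/- arXiv:0811.3055 — 2 statements merged into one kernel-verified Lean document; each statement's English description precedes it below -/
import Mathlib

section
/- Let k ≥ 2 be an integer and r > 0, 0 < ε < 1 constants. With high probability, the width of the random hypergraph HG(n, ⌈r n ln n⌉, k) is at least (1 − ε) k r ln n. -/
/-- Sample space for the random `k`-uniform multihypergraph `HG(n,m,k)`: each of the `m`
hyperedges is a `k`-element subset of `[n]`, chosen independently and uniformly. -/
abbrev HGOmega (n m k : ℕ) := Fin m → {S : Finset (Fin n) // S.card = k}

/-- The probability of an event under the uniform distribution on `HGOmega n m k`. -/
noncomputable def hgPr (n m k : ℕ) (E : HGOmega n m k → Prop) : ℝ :=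
  haveI : DecidablePred E := Classical.decPred E
  ((Finset.univ.filter E).card : ℝ) / (Fintype.card (HGOmega n m k) : ℝ)

/-- The width of a vertex ordering `π` of a finite multihypergraph on vertex set `Fin n`
with hyperedges `edges j`: the maximum over vertices `π i` of the number of hyperedges
containing `π i` all of whose vertices lie in `{π 0, ..., π i}`. -/
def hgWidthOrd {n m : ℕ} (edges : Fin m → Finset (Fin n)) (π : Equiv.Perm (Fin n)) : ℕ :=
  Finset.univ.sup (fun i : Fin n =>
    (Finset.univ.filter
      (fun j : Fin m => π i ∈ edges j ∧ edges j ⊆ (Finset.Iic i).image π)).card)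

/-- The width of a finite multihypergraph: the minimum width over all vertex orderings. -/
noncomputable def hgWidth {n m : ℕ} (edges : Fin m → Finset (Fin n)) : ℕ :=
  sInf (Set.range (hgWidthOrd edges))

/-- Some `t` vertices, namely the last `t` ones in the ordering `π`, meet at most
`t * hgWidthOrd edges π` hyperedges. -/
theorem exists_card_meeting_le_mul_hgWidthOrd {n m : ℕ} (edges : Fin m → Finset (Fin n))
    (π : Equiv.Perm (Fin n)) {t : ℕ} (ht : t ≤ n) :
    ∃ T : Finset (Fin n), T.card = t ∧
      (Finset.univ.filter fun j => ¬ Disjoint (edges j) T).card ≤ t * hgWidthOrd edges π := by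
  classical
  obtain ⟨I, hIcard, hIupper⟩ : ∃ I : Finset (Fin n), I.card = t ∧
      ∀ i ∈ I, ∀ i', i ≤ i' → i' ∈ I := by
    refine ⟨Finset.univ.filter fun i => n - t ≤ (i : ℕ), ?_, fun i hi i' hii' => ?_⟩
    · have hcompl : (Finset.univ.filter fun i : Fin n => (i : ℕ) < n - t).card = n - t := by
        rw [Fin.card_filter_val_lt]
        omega
      have hsum := Finset.card_filter_add_card_filter_not (s := (Finset.univ : Finset (Fin n)))
        (fun i => (i : ℕ) < n - t)
      simp only [not_lt, Finset.card_univ, Fintype.card_fin] at hsum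
      omega
    · simp only [Finset.mem_filter, Finset.mem_univ, true_and] at hi ⊢
      exact hi.trans hii'
  refine ⟨I.image π, by rw [Finset.card_image_of_injective _ π.injective, hIcard], ?_⟩
  have hcover : (Finset.univ.filter fun j => ¬ Disjoint (edges j) (I.image π)) ⊆
      I.biUnion fun i => Finset.univ.filter
        fun j : Fin m => π i ∈ edges j ∧ edges j ⊆ (Finset.Iic i).image π := by
    intro j hj
    simp only [Finset.mem_filter, Finset.mem_univ, true_and, Finset.not_disjoint_iff,
      Finset.mem_image] at hj
    obtain ⟨_, hv, i, hi, rfl⟩ := hj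
    obtain ⟨l, hl, hmax⟩ := (Finset.univ.filter fun i => π i ∈ edges j).exists_max_image id
      ⟨i, by simpa using hv⟩
    simp only [Finset.mem_filter, Finset.mem_univ, true_and, id] at hl hmax
    simp only [Finset.mem_biUnion, Finset.mem_filter, Finset.mem_univ, true_and]
    refine ⟨l, hIupper i hi l (hmax i hv), hl, fun v hv => ?_⟩
    simp only [Finset.mem_image, Finset.mem_Iic]
    exact ⟨π.symm v, hmax _ (by simpa using hv), by simp⟩
  calc _ ≤ _ := Finset.card_le_card hcover
    _ ≤ I.card * hgWidthOrd edges π := Finset.card_biUnion_le_card_mul _ _ _ fun i _ =>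
        Finset.le_sup (f := fun i : Fin n => (Finset.univ.filter
          fun j : Fin m => π i ∈ edges j ∧ edges j ⊆ (Finset.Iic i).image π).card)
          (Finset.mem_univ i)
    _ = t * hgWidthOrd edges π := by rw [hIcard]

/-- Some `t` vertices meet at most `t * hgWidth edges` hyperedges. -/
theorem exists_card_meeting_le_mul_hgWidth {n m : ℕ} (edges : Fin m → Finset (Fin n))
    {t : ℕ} (ht : t ≤ n) :
    ∃ T : Finset (Fin n), T.card = t ∧
      (Finset.univ.filter fun j => ¬ Disjoint (edges j) T).card ≤ t * hgWidth edges := by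
  obtain ⟨π, hπ⟩ := Nat.sInf_mem (Set.range_nonempty (hgWidthOrd edges))
  rw [hgWidth, ← hπ]
  exact exists_card_meeting_le_mul_hgWidthOrd edges π ht

/-- Lower-tail Chernoff bound, in counting form, for the number of coordinates of a uniformly
random element of `Fin m → α` which satisfy `A`. -/
theorem card_filter_card_le_chernoff {α : Type*} [Fintype α] (A : α → Prop) [DecidablePred A]
    (m : ℕ) {p l : ℝ} (b : ℝ) (hl : 0 ≤ l)
    (hp : p * Fintype.card α ≤ ((Finset.univ.filter A).card : ℝ))
    [DecidablePred fun ω : Fin m → α => ((Finset.univ.filter fun j => A (ω j)).card : ℝ) ≤ b] :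
    ((Finset.univ.filter fun ω : Fin m → α =>
        ((Finset.univ.filter fun j => A (ω j)).card : ℝ) ≤ b).card : ℝ) ≤
      (Fintype.card α : ℝ) ^ m * Real.exp (l * b - m * (p * (1 - Real.exp (-l)))) := by
  have hmgf : ∑ a, (if A a then Real.exp (-l) else 1) ≤
      Fintype.card α * Real.exp (-(p * (1 - Real.exp (-l)))) := by
    have hexp : Real.exp (-l) ≤ 1 := Real.exp_le_one_iff.2 (by linarith)
    have hsum : ∑ a, (if A a then Real.exp (-l) else 1) =
        Fintype.card α - (Finset.univ.filter A).card * (1 - Real.exp (-l)) := by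
      have hpoint : ∀ a, (if A a then Real.exp (-l) else 1) =
          1 - (if A a then (1 : ℝ) else 0) * (1 - Real.exp (-l)) := fun a => by
        split_ifs <;> ring
      simp_rw [hpoint]
      rw [Finset.sum_sub_distrib, ← Finset.sum_mul, Finset.sum_boole]
      simp
    have h1 := Real.add_one_le_exp (-(p * (1 - Real.exp (-l))))
    have h2 := mul_le_mul_of_nonneg_left h1 (Nat.cast_nonneg' (α := ℝ) (Fintype.card α))
    have h3 := mul_le_mul_of_nonneg_right hp (sub_nonneg.2 hexp)
    rw [hsum]
    linarith
  have hprod : ∀ ω : Fin m → α, ∏ j, (if A (ω j) then Real.exp (-l) else 1) =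
      Real.exp (-l * (Finset.univ.filter fun j => A (ω j)).card) := fun ω => by
    rw [Finset.prod_ite, Finset.prod_const, Finset.prod_const_one, mul_one, ← Real.exp_nat_mul,
      mul_comm]
  calc _ = ∑ ω : Fin m → α,
        if ((Finset.univ.filter fun j => A (ω j)).card : ℝ) ≤ b then (1 : ℝ) else 0 := by
        rw [Finset.sum_boole]
    _ ≤ ∑ ω : Fin m → α,
        Real.exp (l * b) * ∏ j, (if A (ω j) then Real.exp (-l) else 1) := by
        refine Finset.sum_le_sum fun ω _ => ?_
        rw [hprod, ← Real.exp_add]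
        split_ifs with h
        · exact Real.one_le_exp (by nlinarith)
        · positivity
    _ = Real.exp (l * b) * (∑ a, (if A a then Real.exp (-l) else 1)) ^ m := by
        rw [← Finset.mul_sum, Fintype.sum_pow]
    _ ≤ Real.exp (l * b) *
        (Fintype.card α * Real.exp (-(p * (1 - Real.exp (-l))))) ^ m := by
        gcongr
    _ = _ := by
        rw [mul_pow, ← Real.exp_nat_mul, mul_left_comm, ← Real.exp_add]
        congr 2
        ring

theorem Nat.descFactorial_mul_pow_le {a n : ℕ} (h : a ≤ n) (k : ℕ) :
    a.descFactorial k * n ^ k ≤ n.descFactorial k * a ^ k := by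
  induction k with
  | zero => simp
  | succ k ih =>
    have hstep : (a - k) * n ≤ (n - k) * a := by
      rw [Nat.sub_mul, Nat.sub_mul, Nat.mul_comm n a]
      exact Nat.sub_le_sub_left (Nat.mul_le_mul_left k h) _
    calc _ = ((a - k) * n) * (a.descFactorial k * n ^ k) := by
          rw [Nat.descFactorial_succ]; ring
      _ ≤ ((n - k) * a) * (n.descFactorial k * a ^ k) := Nat.mul_le_mul hstep ih
      _ = _ := by rw [Nat.descFactorial_succ]; ring

theorem Nat.choose_mul_pow_le {a n : ℕ} (h : a ≤ n) (k : ℕ) :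
    a.choose k * n ^ k ≤ n.choose k * a ^ k := by
  have := Nat.descFactorial_mul_pow_le h k
  rw [Nat.descFactorial_eq_factorial_mul_choose, Nat.descFactorial_eq_factorial_mul_choose,
    mul_assoc, mul_assoc] at this
  exact Nat.le_of_mul_le_mul_left this k.factorial_pos

/-- At least a proportion `1 - exp (-(k * t / n))` of all `k`-subsets of `Fin n` meet a given
set of size `t`. -/
theorem card_meeting_ge {n k : ℕ} (hn : 0 < n) (T : Finset (Fin n)) :
    (1 - Real.exp (-(k * (T.card / n : ℝ)))) *
        (Fintype.card {S : Finset (Fin n) // S.card = k} : ℝ) ≤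
      ((Finset.univ.filter
        fun S : {S : Finset (Fin n) // S.card = k} => ¬ Disjoint S.1 T).card : ℝ) := by
  classical
  have hT : T.card ≤ n := by simpa using T.card_le_univ
  have hcard : Fintype.card {S : Finset (Fin n) // S.card = k} = n.choose k := by
    simp [Fintype.card_finset_len]
  have hdisj : (Finset.univ.filter
      fun S : {S : Finset (Fin n) // S.card = k} => Disjoint S.1 T).card =
      (n - T.card).choose k := by
    rw [← Finset.card_map (Function.Embedding.subtype _)]
    have hmap : (Finset.univ.filter
        fun S : {S : Finset (Fin n) // S.card = k} => Disjoint S.1 T).map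
          (Function.Embedding.subtype _) = Tᶜ.powersetCard k := by
      ext S
      simp [Finset.mem_powersetCard, Finset.subset_compl_iff_disjoint_right, and_comm]
    rw [hmap, Finset.card_powersetCard, Finset.card_compl, Fintype.card_fin]
  have hsum := Finset.card_filter_add_card_filter_not
    (s := (Finset.univ : Finset {S : Finset (Fin n) // S.card = k}))
    (fun S => Disjoint S.1 T)
  rw [hdisj, Finset.card_univ, hcard] at hsum
  have hsum' : ((n - T.card).choose k : ℝ) + ((Finset.univ.filter
      fun S : {S : Finset (Fin n) // S.card = k} => ¬ Disjoint S.1 T).card : ℝ) =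
      (n.choose k : ℝ) := by exact_mod_cast hsum
  have hn' : (0 : ℝ) < n := by exact_mod_cast hn
  have hchoose : ((n - T.card).choose k : ℝ) ≤
      n.choose k * Real.exp (-(k * (T.card / n : ℝ))) := by
    have h1 : ((n - T.card).choose k : ℝ) * (n : ℝ) ^ k ≤
        n.choose k * ((n : ℝ) - T.card) ^ k := by
      rw [← Nat.cast_sub hT]
      exact_mod_cast Nat.choose_mul_pow_le (Nat.sub_le n T.card) k
    have h2 : ((n : ℝ) - T.card) ^ k ≤
        (n : ℝ) ^ k * Real.exp (-(k * (T.card / n : ℝ))) := by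
      have h3 : (n : ℝ) - T.card ≤ n * Real.exp (-(T.card / n : ℝ)) := by
        have h4 := mul_le_mul_of_nonneg_left (Real.add_one_le_exp (-(T.card / n : ℝ))) hn'.le
        have h5 : (n : ℝ) * (-(T.card / n : ℝ) + 1) = n - T.card := by
          field_simp
          ring
        linarith
      have h6 : (0 : ℝ) ≤ (n : ℝ) - T.card := sub_nonneg.2 (by exact_mod_cast hT)
      calc _ ≤ ((n : ℝ) * Real.exp (-(T.card / n : ℝ))) ^ k := by gcongr
        _ = _ := by rw [mul_pow, ← Real.exp_nat_mul]; congr 2; ring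
    refine le_of_mul_le_mul_right ?_ (pow_pos hn' k)
    calc _ ≤ _ := h1
      _ ≤ (n.choose k : ℝ) * ((n : ℝ) ^ k * Real.exp (-(k * (T.card / n : ℝ)))) := by gcongr
      _ = _ := by ring
  rw [hcard]
  linarith

theorem one_sub_exp_neg_ge {x : ℝ} (hx : 0 ≤ x) : x / (1 + x) ≤ 1 - Real.exp (-x) := by
  have h1 := Real.add_one_le_exp x
  have h2 : Real.exp (-x) ≤ (1 + x)⁻¹ := by
    rw [Real.exp_neg]
    exact inv_anti₀ (by linarith) (by linarith)
  have h3 : x / (1 + x) = 1 - (1 + x)⁻¹ := by field_simp; ring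
  linarith

theorem hgPr_not {n k : ℕ} (m : ℕ) (hkn : k ≤ n) (E : HGOmega n m k → Prop) :
    hgPr n m k E = 1 - hgPr n m k (fun ω => ¬ E ω) := by
  classical
  have hpos : (0 : ℝ) < (Fintype.card (HGOmega n m k) : ℝ) := by
    have : 0 < Fintype.card {S : Finset (Fin n) // S.card = k} := by
      simpa [Fintype.card_finset_len] using Nat.choose_pos hkn
    simp only [HGOmega, Fintype.card_fun, Fintype.card_fin]
    exact_mod_cast pow_pos this m
  have hsum := Finset.card_filter_add_card_filter_not
    (s := (Finset.univ : Finset (HGOmega n m k))) E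
  rw [Finset.card_univ] at hsum
  unfold hgPr
  rw [eq_sub_iff_add_eq, ← add_div, div_eq_one_iff_eq hpos.ne']
  convert congrArg (Nat.cast (R := ℝ)) hsum using 1
  push_cast
  congr!

/-- The union bound over all sets `T` of `t` vertices: small width is unlikely. -/
theorem hgPr_hgWidth_lt_le {n m k t : ℕ} (hn : 0 < n) (ht : t ≤ n) {l : ℝ} (hl : 0 ≤ l)
    (w : ℝ) :
    hgPr n m k (fun ω => (hgWidth (fun j => (ω j).1) : ℝ) < w) ≤
      2 ^ n * Real.exp (l * (t * w) -
        m * ((1 - Real.exp (-(k * (t / n : ℝ)))) * (1 - Real.exp (-l)))) := by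
  classical
  set B := Real.exp (l * (t * w) -
    m * ((1 - Real.exp (-(k * (t / n : ℝ)))) * (1 - Real.exp (-l))))
  set N := (Fintype.card {S : Finset (Fin n) // S.card = k} : ℝ) ^ m with hN
  have hcover : (Finset.univ.filter fun ω : HGOmega n m k =>
      (hgWidth (fun j => (ω j).1) : ℝ) < w) ⊆
      (Finset.univ.powersetCard t).biUnion fun T => Finset.univ.filter
        fun ω : HGOmega n m k => ((Finset.univ.filter
          fun j => ¬ Disjoint (ω j).1 T).card : ℝ) ≤ t * w := by
    intro ω hω
    simp only [Finset.mem_filter, Finset.mem_univ, true_and] at hω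
    obtain ⟨T, hTcard, hT⟩ := exists_card_meeting_le_mul_hgWidth (fun j => (ω j).1) ht
    simp only [Finset.mem_biUnion, Finset.mem_filter, Finset.mem_univ, true_and,
      Finset.mem_powersetCard]
    refine ⟨T, ⟨Finset.subset_univ T, hTcard⟩, ?_⟩
    calc _ ≤ ((t * hgWidth (fun j => (ω j).1) : ℕ) : ℝ) := by exact_mod_cast hT
      _ = t * (hgWidth (fun j => (ω j).1) : ℝ) := by push_cast; rfl
      _ ≤ t * w := by gcongr
  have hcount : ((Finset.univ.filter fun ω : HGOmega n m k =>
      (hgWidth (fun j => (ω j).1) : ℝ) < w).card : ℝ) ≤ 2 ^ n * B * N := by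
    calc _ ≤ (((Finset.univ.powersetCard t).biUnion fun T => Finset.univ.filter
          fun ω : HGOmega n m k => ((Finset.univ.filter
            fun j => ¬ Disjoint (ω j).1 T).card : ℝ) ≤ t * w).card : ℝ) := by
          exact_mod_cast Finset.card_le_card hcover
      _ ≤ ∑ T ∈ (Finset.univ : Finset (Fin n)).powersetCard t, ((Finset.univ.filter
          fun ω : HGOmega n m k => ((Finset.univ.filter
            fun j => ¬ Disjoint (ω j).1 T).card : ℝ) ≤ t * w).card : ℝ) := by
          exact_mod_cast Finset.card_biUnion_le
      _ ≤ ∑ T ∈ (Finset.univ : Finset (Fin n)).powersetCard t, N * B := by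
          refine Finset.sum_le_sum fun T hT => ?_
          have hTcard := (Finset.mem_powersetCard.1 hT).2
          have hmeet := card_meeting_ge (k := k) hn T
          rw [hTcard] at hmeet
          exact card_filter_card_le_chernoff
            (fun S : {S : Finset (Fin n) // S.card = k} => ¬ Disjoint S.1 T) m (t * w) hl hmeet
      _ = n.choose t * (N * B) := by simp
      _ ≤ 2 ^ n * (N * B) := by
          gcongr
          exact_mod_cast Nat.choose_le_two_pow n t
      _ = _ := by ring
  unfold hgPr
  refine div_le_of_le_mul₀ (by positivity) (by positivity) ?_
  have hcard : (Fintype.card (HGOmega n m k) : ℝ) = N := by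
    simp only [HGOmega, Fintype.card_fun, Fintype.card_fin, hN]
    push_cast
    rfl
  rw [hcard]
  convert hcount using 3

/-- The exponent in `hgPr_hgWidth_lt_le`, for `t` a small proportion of `n`. -/
theorem exponent_le {ε x d M b : ℝ} (hε0 : 0 < ε) (hε1 : ε < 1) (hx : x = ε / 4)
    (hd : x / 2 ≤ d) (hdx : d ≤ x) (hM : 0 ≤ M) (hb : b ≤ (1 - ε) * d * M) :
    x * b - M * ((1 - Real.exp (-d)) * (1 - Real.exp (-x))) ≤ -(ε ^ 4 / 64 * M) := by
  have hx0 : 0 < x := by linarith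
  have hd0 : 0 < d := by linarith
  have h1 := one_sub_exp_neg_ge hd0.le
  have h2 := one_sub_exp_neg_ge hx0.le
  have h3 : d / (1 + x) ≤ d / (1 + d) := by gcongr
  have h4 : d * x * (1 - ε + ε ^ 2 / 2) ≤ d / (1 + x) * (x / (1 + x)) := by
    rw [div_mul_div_comm, le_div_iff₀ (by positivity), mul_assoc]
    refine mul_le_of_le_one_right (by positivity) ?_
    have h5 : (1 + x) * (1 + x) ≤ 1 + ε := by subst hx; nlinarith
    have h6 : 0 ≤ 1 - ε + ε ^ 2 / 2 := by nlinarith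
    have h7 : (1 - ε + ε ^ 2 / 2) * (1 + ε) ≤ 1 := by nlinarith [pow_pos hε0 2]
    exact (mul_le_mul_of_nonneg_left h5 h6).trans h7
  have h8 : d / (1 + x) * (x / (1 + x)) ≤
      (1 - Real.exp (-d)) * (1 - Real.exp (-x)) := by
    have : 0 ≤ d / (1 + d) := by positivity
    exact mul_le_mul (h3.trans h1) h2 (by positivity) (this.trans h1)
  have h9 := mul_le_mul_of_nonneg_left (h4.trans h8) hM
  have h10 := mul_le_mul_of_nonneg_left hb hx0.le
  have h11 : ε ^ 4 / 64 ≤ d * x * (ε ^ 2 / 2) := by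
    have : x / 2 * x * (ε ^ 2 / 2) ≤ d * x * (ε ^ 2 / 2) := by gcongr
    refine le_trans (le_of_eq ?_) this
    subst hx
    ring
  have h12 := mul_le_mul_of_nonneg_right h11 hM
  linarith

/-- For `k ≥ 2`, `r > 0` and `0 < ε < 1`, with high probability the width of
`HG(n, ⌈r n ln n⌉, k)` is at least `(1 - ε) k r ln n`. -/
theorem hg_width_lower (k : ℕ) (hk : 2 ≤ k) (r ε : ℝ) (hr : 0 < r) (hε0 : 0 < ε)
    (hε1 : ε < 1) :
    Filter.Tendsto
      (fun n : ℕ => hgPr n ⌈r * n * Real.log n⌉₊ k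
        (fun ω => (hgWidth (fun j => (ω j).1) : ℝ) ≥ (1 - ε) * k * r * Real.log n))
      Filter.atTop (nhds 1) := by
  set c := ε ^ 4 / 64 * r with hc
  have hc0 : 0 < c := by positivity
  have hk0 : (0 : ℝ) < k := by exact_mod_cast (by omega : 0 < k)
  have hk1 : (1 : ℝ) ≤ k := by exact_mod_cast (by omega : 1 ≤ k)
  have hlog : Filter.Tendsto (fun n : ℕ => Real.log n) Filter.atTop Filter.atTop :=
    Real.tendsto_log_atTop.comp tendsto_natCast_atTop_atTop
  have hexp : Filter.Tendsto (fun n : ℕ => 1 - Real.exp (-(n : ℝ))) Filter.atTop (nhds 1) := by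
    simpa using (Real.tendsto_exp_neg_atTop_nhds_zero.comp
      (tendsto_natCast_atTop_atTop (R := ℝ))).const_sub 1
  refine tendsto_of_tendsto_of_tendsto_of_le_of_le' hexp tendsto_const_nhds ?_ ?_
  · filter_upwards [Filter.eventually_ge_atTop k, hlog.eventually_ge_atTop (2 / c),
      (tendsto_natCast_atTop_atTop (R := ℝ)).eventually_ge_atTop (2 / (ε / (4 * k)))]
      with n hkn hlogn hlarge
    have hn : 0 < n := by omega
    have hn' : (0 : ℝ) < n := by exact_mod_cast hn
    set m := ⌈r * n * Real.log n⌉₊ with hm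
    have hmge : r * n * Real.log n ≤ m := Nat.le_ceil _
    set δ := ε / (4 * k) with hδ
    have hδ0 : 0 < δ := by positivity
    have hkδ : k * δ = ε / 4 := by rw [hδ]; field_simp
    have hδ1 : δ ≤ 1 := by nlinarith
    set t := ⌊δ * n⌋₊ with ht
    have htle : (t : ℝ) ≤ δ * n := Nat.floor_le (by positivity)
    have htge : δ * n / 2 ≤ t := by
      have h1 := Nat.lt_floor_add_one (δ * n)
      rw [div_le_iff₀ hδ0] at hlarge
      linarith
    have htn : t ≤ n := by
      have : (t : ℝ) ≤ n := htle.trans (mul_le_of_le_one_left hn'.le hδ1)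
      exact_mod_cast this
    have hdx : k * (t / n : ℝ) ≤ ε / 4 := by
      rw [← hkδ]
      gcongr
      rwa [div_le_iff₀ hn']
    have hxd : ε / 4 / 2 ≤ k * (t / n : ℝ) := by
      rw [← hkδ, mul_div_assoc]
      refine mul_le_mul_of_nonneg_left ?_ hk0.le
      rw [le_div_iff₀ hn']
      linarith
    have hb : t * ((1 - ε) * k * r * Real.log n) ≤ (1 - ε) * (k * (t / n : ℝ)) * m := by
      calc _ = (1 - ε) * (k * (t / n : ℝ)) * (r * n * Real.log n) := by field_simp
        _ ≤ _ := by
          have : 0 ≤ 1 - ε := by linarith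
          gcongr
    have hexponent := exponent_le hε0 hε1 rfl hxd hdx (Nat.cast_nonneg m) hb
    have hbound := hgPr_hgWidth_lt_le (m := m) (k := k) hn htn (by positivity : 0 ≤ ε / 4)
      ((1 - ε) * k * r * Real.log n)
    rw [hgPr_not m hkn]
    simp only [ge_iff_le, not_le]
    refine sub_le_sub_left (hbound.trans ?_) 1
    have htwo : (2 : ℝ) ^ n ≤ Real.exp n := by
      have := Real.add_one_le_exp (1 : ℝ)
      rw [← Real.exp_one_pow]
      gcongr
      linarith
    have hdecay : 2 * n ≤ ε ^ 4 / 64 * m := by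
      rw [div_le_iff₀ hc0] at hlogn
      have h1 : 2 * n ≤ Real.log n * c * n := by gcongr
      have h2 : ε ^ 4 / 64 * (r * n * Real.log n) ≤ ε ^ 4 / 64 * m := by gcongr
      rw [hc] at h1
      linarith
    calc _ ≤ Real.exp n * Real.exp (-(ε ^ 4 / 64 * m)) := by gcongr
      _ ≤ Real.exp (-(n : ℝ)) := by
        rw [← Real.exp_add]
        gcongr
        linarith
  · refine Filter.Eventually.of_forall fun n => ?_
    unfold hgPr
    exact div_le_one_of_le₀ (by exact_mod_cast Finset.card_le_univ _) (by positivity)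
end

section
/- Let k ≥ 2 be an integer, r > 0 a constant, and fix a vertex u of [n]. In HG(n, ⌈r n ln n⌉, k), with high probability no hyperedge is entirely contained in N_u \ {u}, where N_u denotes the union of all hyperedges containing u. -/
theorem Nat.choose_sub_mul_pow_le {n k t : ℕ} (htk : t ≤ k) (hkn : k ≤ n) :
    (n - t).choose (k - t) * n ^ t ≤ k ^ t * n.choose k := by
  induction t with
  | zero => simp
  | succ t ih =>
    obtain ⟨b, rfl⟩ := Nat.exists_eq_add_of_le htk
    obtain ⟨a, rfl⟩ := Nat.exists_eq_add_of_le hkn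
    have ih := ih (by omega)
    have e₁ : t + 1 + b + a - (t + 1) = b + a := by omega
    have e₂ : t + 1 + b - (t + 1) = b := by omega
    have e₃ : t + 1 + b + a - t = b + a + 1 := by omega
    have e₄ : t + 1 + b - t = b + 1 := by omega
    rw [e₁, e₂]
    rw [e₃, e₄] at ih
    have step : (b + a).choose b * (t + 1 + b + a) ≤
        (t + 1 + b) * (b + a + 1).choose (b + 1) := by
      have h₁ := Nat.add_one_mul_choose_eq (b + a) b
      have h₂ : (b + a).choose b ≤ (b + a + 1).choose (b + 1) := by
        rw [Nat.choose_succ_succ]; exact Nat.le_add_right _ _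
      nlinarith [Nat.mul_le_mul_left t h₂]
    calc (b + a).choose b * (t + 1 + b + a) ^ (t + 1)
        = (b + a).choose b * (t + 1 + b + a) * (t + 1 + b + a) ^ t := by ring
      _ ≤ (t + 1 + b) * (b + a + 1).choose (b + 1) * (t + 1 + b + a) ^ t := by gcongr
      _ = (t + 1 + b) * ((b + a + 1).choose (b + 1) * (t + 1 + b + a) ^ t) := by ring
      _ ≤ (t + 1 + b) * ((t + 1 + b) ^ t * (t + 1 + b + a).choose (t + 1 + b)) := by gcongr
      _ = _ := by ring

/-- At most a `(k / n) ^ |S|` proportion of the `k`-subsets of `[n]` contain `S`. -/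
theorem card_supersets_le {n k : ℕ} (S : Finset (Fin n)) :
    (((Finset.univ : Finset {e : Finset (Fin n) // e.card = k}).filter
      (fun e => S ⊆ e.1)).card : ℝ) ≤ ((k : ℝ) / n) ^ S.card * n.choose k := by
  rcases ((Finset.univ : Finset {e : Finset (Fin n) // e.card = k}).filter
      (fun e => S ⊆ e.1)).eq_empty_or_nonempty with h | ⟨e, he⟩
  · rw [h]; simp only [Finset.card_empty, Nat.cast_zero]; positivity
  have hS : S.card ≤ k := e.2 ▸ Finset.card_le_card (Finset.mem_filter.1 he).2
  have hkn : k ≤ n := by simpa [e.2] using Finset.card_le_univ e.1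
  have hcard : ((Finset.univ : Finset {e : Finset (Fin n) // e.card = k}).filter
      (fun e => S ⊆ e.1)).card ≤ (n - S.card).choose (k - S.card) := by
    have := Finset.card_le_card_of_injOn
      (s := (Finset.univ : Finset {e : Finset (Fin n) // e.card = k}).filter
        (fun e => S ⊆ e.1)) (t := Sᶜ.powersetCard (k - S.card)) (fun e => e.1 \ S) ?_ ?_
    · simpa [Finset.card_compl] using this
    · intro e he
      have he : S ⊆ e.1 := by simpa using he
      simp only [Finset.mem_coe, Finset.mem_powersetCard]
      refine ⟨fun x hx => by simpa using (Finset.mem_sdiff.1 hx).2, ?_⟩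
      rw [Finset.card_sdiff_of_subset he, e.2]
    · intro e he f hf hef
      have he : S ⊆ e.1 := by simpa using he
      have hf : S ⊆ f.1 := by simpa using hf
      apply Subtype.ext
      rw [← Finset.sdiff_union_of_subset he, ← Finset.sdiff_union_of_subset hf]
      exact congrArg (· ∪ S) hef
  rcases Nat.eq_zero_or_pos n with rfl | hn
  · have h0 : S.card = 0 := by omega
    rw [h0]
    simp
  have hn' : (0 : ℝ) < n := by exact_mod_cast hn
  rw [div_pow, div_mul_eq_mul_div, le_div_iff₀ (by positivity)]
  exact_mod_cast (Nat.mul_le_mul_right _ hcard).trans (Nat.choose_sub_mul_pow_le hS hkn)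

theorem card_hgOmega (n m k : ℕ) : Fintype.card (HGOmega n m k) = n.choose k ^ m := by
  simp [HGOmega]

theorem hgPr_eq {n m k : ℕ} (E : HGOmega n m k → Prop) [DecidablePred E] :
    hgPr n m k E = ((Finset.univ.filter E).card : ℝ) / Fintype.card (HGOmega n m k) := by
  unfold hgPr; congr!

theorem hgPr_mono {n m k : ℕ} {E F : HGOmega n m k → Prop} (h : ∀ ω, E ω → F ω) :
    hgPr n m k E ≤ hgPr n m k F := by
  classical
  rw [hgPr_eq, hgPr_eq]
  gcongr with ω
  exact h ω

theorem hgPr_or_le {n m k : ℕ} (E F : HGOmega n m k → Prop) :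
    hgPr n m k (fun ω => E ω ∨ F ω) ≤ hgPr n m k E + hgPr n m k F := by
  classical
  rw [hgPr_eq, hgPr_eq, hgPr_eq, ← add_div, Finset.filter_or]
  gcongr
  exact_mod_cast Finset.card_union_le _ _

theorem hgPr_exists_le {n m k : ℕ} {ι : Type*} (T : Finset ι)
    (E : ι → HGOmega n m k → Prop) :
    hgPr n m k (fun ω => ∃ t ∈ T, E t ω) ≤ ∑ t ∈ T, hgPr n m k (E t) := by
  classical
  induction T using Finset.induction_on with
  | empty => simp [hgPr]
  | insert t T ht ih =>
    rw [Finset.sum_insert ht]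
    refine (hgPr_mono ?_).trans ((hgPr_or_le (E t) (fun ω => ∃ t ∈ T, E t ω)).trans ?_)
    · simp
    · gcongr

theorem hgPr_le_one {n m k : ℕ} (E : HGOmega n m k → Prop) : hgPr n m k E ≤ 1 := by
  classical
  rw [hgPr_eq]
  exact div_le_one_of_le₀ (by exact_mod_cast Finset.card_le_univ _) (by positivity)

theorem one_le_hgPr_add_hgPr_not {n m k : ℕ} (hkn : k ≤ n) (E : HGOmega n m k → Prop) :
    1 ≤ hgPr n m k E + hgPr n m k (fun ω => ¬ E ω) := by
  classical
  have hpos : (0 : ℝ) < Fintype.card (HGOmega n m k) := by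
    rw [card_hgOmega]
    exact_mod_cast pow_pos (Nat.choose_pos hkn) m
  rw [hgPr_eq, hgPr_eq, ← add_div, le_div_iff₀ hpos, one_mul]
  exact_mod_cast (Finset.card_filter_add_card_filter_not (s := Finset.univ) E).ge

/-- The probability that each hyperedge `i` contains a prescribed set `S i`. -/
theorem hgPr_forall_subset_le {n m k : ℕ} (S : Fin m → Finset (Fin n)) :
    hgPr n m k (fun ω => ∀ i, S i ⊆ (ω i).1) ≤ ((k : ℝ) / n) ^ (∑ i, (S i).card) := by
  classical
  rw [hgPr_eq]
  refine div_le_of_le_mul₀ (by positivity) (by positivity) ?_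
  have h : (Finset.univ.filter (fun ω : HGOmega n m k => ∀ i, S i ⊆ (ω i).1)) =
      Fintype.piFinset (fun i => Finset.univ.filter (fun e => S i ⊆ e.1)) := by
    ext ω; simp [Fintype.mem_piFinset]
  rw [h, Fintype.card_piFinset, card_hgOmega, ← Finset.prod_pow_eq_pow_sum]
  push_cast
  calc _ ≤ ∏ i, ((k : ℝ) / n) ^ (S i).card * (n.choose k : ℝ) :=
        Finset.prod_le_prod (fun _ _ => by positivity) (fun i _ => card_supersets_le (S i))
    _ = _ := by simp [Finset.prod_mul_distrib]

theorem hgPr_exists_forall_subset_le {n m k : ℕ} {ι : Type*} (T : Finset ι) (d : ℕ)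
    (S : ι → Fin m → Finset (Fin n)) (hS : ∀ t ∈ T, ∑ i, (S t i).card = d) :
    hgPr n m k (fun ω => ∃ t ∈ T, ∀ i, S t i ⊆ (ω i).1) ≤ T.card * ((k : ℝ) / n) ^ d := by
  refine (hgPr_exists_le T _).trans ?_
  rw [← nsmul_eq_mul]
  exact Finset.sum_le_card_nsmul _ _ _ fun t ht => hS t ht ▸ hgPr_forall_subset_le (S t)

theorem hgPr_edge_in_neighborhood_le {n m k : ℕ} (hk : 2 ≤ k) (u : Fin n) :
    hgPr n m k (fun ω => ∃ j, (ω j).1 ⊆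
      ((Finset.univ.filter (fun j' => u ∈ (ω j').1)).biUnion (fun j' => (ω j').1)).erase u) ≤
      (m : ℝ) ^ 3 * n ^ 2 * (k / n) ^ 6 + (m : ℝ) ^ 2 * n ^ 2 * (k / n) ^ 5 := by
  classical
  let T₁ : Finset ((Fin m × Fin m × Fin m) × Fin n × Fin n) := Finset.univ.filter fun t =>
    t.1.1 ≠ t.1.2.1 ∧ t.1.1 ≠ t.1.2.2 ∧ t.1.2.1 ≠ t.1.2.2 ∧
      t.2.1 ≠ t.2.2 ∧ t.2.1 ≠ u ∧ t.2.2 ≠ u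
  let T₂ : Finset ((Fin m × Fin m) × Fin n × Fin n) := Finset.univ.filter fun t =>
    t.1.1 ≠ t.1.2 ∧ t.2.1 ≠ t.2.2 ∧ t.2.1 ≠ u ∧ t.2.2 ≠ u
  let S₁ : (Fin m × Fin m × Fin m) × Fin n × Fin n → Fin m → Finset (Fin n) := fun t i =>
    if i = t.1.1 then {t.2.1, t.2.2} else if i = t.1.2.1 then {u, t.2.1}
      else if i = t.1.2.2 then {u, t.2.2} else ∅
  let S₂ : (Fin m × Fin m) × Fin n × Fin n → Fin m → Finset (Fin n) := fun t i =>
    if i = t.1.1 then {t.2.1, t.2.2} else if i = t.1.2 then {u, t.2.1, t.2.2} else ∅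
  have hS₁ : ∀ t ∈ T₁, ∑ i, (S₁ t i).card = 6 := by
    rintro ⟨⟨j, a, b⟩, v, w⟩ ht
    simp only [T₁, Finset.mem_filter, Finset.mem_univ, true_and] at ht
    obtain ⟨hja, hjb, hab, hvw, hv, hw⟩ := ht
    have h : ∀ i, (S₁ ((j, a, b), v, w) i).card =
        (if i = j then 2 else 0) + (if i = a then 2 else 0) + (if i = b then 2 else 0) := by
      intro i
      have := Finset.card_pair hvw
      have := Finset.card_pair hv.symm
      have := Finset.card_pair hw.symm
      simp only [S₁]
      split_ifs <;> simp_all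
    simp [h, Finset.sum_add_distrib]
  have hS₂ : ∀ t ∈ T₂, ∑ i, (S₂ t i).card = 5 := by
    rintro ⟨⟨j, a⟩, v, w⟩ ht
    simp only [T₂, Finset.mem_filter, Finset.mem_univ, true_and] at ht
    obtain ⟨hja, hvw, hv, hw⟩ := ht
    have h : ∀ i, (S₂ ((j, a), v, w) i).card =
        (if i = j then 2 else 0) + (if i = a then 3 else 0) := by
      intro i
      have := Finset.card_pair hvw
      have : ({u, v, w} : Finset (Fin n)).card = 3 :=
        Finset.card_eq_three.2 ⟨u, v, w, hv.symm, hw.symm, hvw, rfl⟩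
      simp only [S₂]
      split_ifs <;> simp_all
    simp [h, Finset.sum_add_distrib]
  have hT₁ : (T₁.card : ℝ) ≤ (m : ℝ) ^ 3 * n ^ 2 := by
    have := Finset.card_le_univ T₁
    simp only [Fintype.card_prod, Fintype.card_fin] at this
    calc (T₁.card : ℝ) ≤ ((m * (m * m) * (n * n) : ℕ) : ℝ) := by exact_mod_cast this
      _ = _ := by push_cast; ring
  have hT₂ : (T₂.card : ℝ) ≤ (m : ℝ) ^ 2 * n ^ 2 := by
    have := Finset.card_le_univ T₂
    simp only [Fintype.card_prod, Fintype.card_fin] at this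
    calc (T₂.card : ℝ) ≤ ((m * m * (n * n) : ℕ) : ℝ) := by exact_mod_cast this
      _ = _ := by push_cast; ring
  calc _ ≤ hgPr n m k (fun ω => (∃ t ∈ T₁, ∀ i, S₁ t i ⊆ (ω i).1) ∨
        ∃ t ∈ T₂, ∀ i, S₂ t i ⊆ (ω i).1) := by
        refine hgPr_mono ?_
        rintro ω ⟨j, hj⟩
        obtain ⟨v, hv, w, hw, hvw⟩ := Finset.one_lt_card.1 (by rw [(ω j).2]; omega)
        have huj : u ∉ (ω j).1 := fun h => Finset.notMem_erase u _ (hj h)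
        obtain ⟨hvu, hv'⟩ := Finset.mem_erase.1 (hj hv)
        obtain ⟨hwu, hw'⟩ := Finset.mem_erase.1 (hj hw)
        simp only [Finset.mem_biUnion, Finset.mem_filter, Finset.mem_univ, true_and] at hv' hw'
        obtain ⟨a, hua, hva⟩ := hv'
        obtain ⟨b, hub, hwb⟩ := hw'
        have hja : j ≠ a := fun h => huj (h ▸ hua)
        have hjb : j ≠ b := fun h => huj (h ▸ hub)
        by_cases hab : a = b
        · subst hab
          refine Or.inr ⟨((j, a), v, w), by simp [T₂, *], fun i => ?_⟩
          simp only [S₂]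
          split_ifs <;> simp_all [Finset.insert_subset_iff]
        · refine Or.inl ⟨((j, a, b), v, w), by simp [T₁, *], fun i => ?_⟩
          simp only [S₁]
          split_ifs <;> simp_all [Finset.insert_subset_iff]
    _ ≤ T₁.card * ((k : ℝ) / n) ^ 6 + T₂.card * ((k : ℝ) / n) ^ 5 :=
        (hgPr_or_le _ _).trans (add_le_add (hgPr_exists_forall_subset_le T₁ 6 S₁ hS₁)
          (hgPr_exists_forall_subset_le T₂ 5 S₂ hS₂))
    _ ≤ _ := by gcongr

theorem tendsto_log_pow_div_natCast (d : ℕ) :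
    Filter.Tendsto (fun n : ℕ => Real.log n ^ d / n) Filter.atTop (nhds 0) :=
  ((Real.isLittleO_pow_log_id_atTop (n := d)).tendsto_div_nhds_zero).comp
    tendsto_natCast_atTop_atTop

/-- For `k ≥ 2`, `r > 0` and a fixed vertex `u` of `[n]` (given as a family of vertex
indices `u n < n`): in `HG(n, ⌈r n ln n⌉, k)`, with high probability no hyperedge is
entirely contained in `N_u \ {u}`, where `N_u` is the union of all hyperedges
containing `u`. -/
theorem hg_no_edge_in_neighborhood (k : ℕ) (hk : 2 ≤ k) (r : ℝ) (hr : 0 < r)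
    (u : ℕ → ℕ) (hu : ∀ n : ℕ, 1 ≤ n → u n < n) :
    Filter.Tendsto
      (fun n : ℕ => hgPr n ⌈r * n * Real.log n⌉₊ k
        (fun ω => ∀ h : u n < n,
          ¬ ∃ j, (ω j).1 ⊆
            (((Finset.univ.filter (fun j' => (⟨u n, h⟩ : Fin n) ∈ (ω j').1)).biUnion
              (fun j' => (ω j').1)).erase ⟨u n, h⟩)))
      Filter.atTop (nhds 1) := by
  have hlim : Filter.Tendsto (fun n : ℕ => 1 - (k ^ 6 * (r + 1) ^ 3 * (Real.log n ^ 3 / n) +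
      k ^ 5 * (r + 1) ^ 2 * (Real.log n ^ 2 / n))) Filter.atTop (nhds 1) := by
    simpa using tendsto_const_nhds.sub
      (((tendsto_log_pow_div_natCast 3).const_mul ((k : ℝ) ^ 6 * (r + 1) ^ 3)).add
        ((tendsto_log_pow_div_natCast 2).const_mul ((k : ℝ) ^ 5 * (r + 1) ^ 2)))
  refine tendsto_of_tendsto_of_tendsto_of_le_of_le' hlim tendsto_const_nhds ?_
    (Filter.Eventually.of_forall fun n => hgPr_le_one _)
  filter_upwards [Filter.eventually_ge_atTop (max k 3)] with n hn
  have hkn : k ≤ n := (le_max_left _ _).trans hn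
  have hn3 : (3 : ℝ) ≤ n := by exact_mod_cast (le_max_right _ _).trans hn
  have hun : u n < n := hu n (by omega)
  have hlog : 1 ≤ Real.log n := by
    rw [Real.le_log_iff_exp_le (by linarith)]
    linarith [Real.exp_one_lt_d9]
  set m := ⌈r * n * Real.log n⌉₊
  have hm : (m : ℝ) ≤ (r + 1) * Real.log n * n := by
    have := Nat.ceil_lt_add_one (show 0 ≤ r * n * Real.log n by positivity)
    nlinarith
  have hbad := hgPr_edge_in_neighborhood_le (m := m) hk ⟨u n, hun⟩
  have hone := one_le_hgPr_add_hgPr_not hkn (fun ω : HGOmega n m k => ∃ j, (ω j).1 ⊆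
    ((Finset.univ.filter (fun j' => (⟨u n, hun⟩ : Fin n) ∈ (ω j').1)).biUnion
      (fun j' => (ω j').1)).erase ⟨u n, hun⟩)
  have hbound : (m : ℝ) ^ 3 * n ^ 2 * (k / n) ^ 6 + (m : ℝ) ^ 2 * n ^ 2 * (k / n) ^ 5 ≤
      k ^ 6 * (r + 1) ^ 3 * (Real.log n ^ 3 / n) + k ^ 5 * (r + 1) ^ 2 * (Real.log n ^ 2 / n) := by
    calc _ ≤ ((r + 1) * Real.log n * n) ^ 3 * n ^ 2 * (k / n) ^ 6 +
          ((r + 1) * Real.log n * n) ^ 2 * n ^ 2 * (k / n) ^ 5 := by gcongr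
      _ = _ := by field_simp
  have hgood : ∀ p : ∀ _ : u n < n, HGOmega n m k → Prop,
      hgPr n m k (fun ω => p hun ω) ≤ hgPr n m k (fun ω => ∀ h, p h ω) :=
    fun p => hgPr_mono fun ω hω _ => hω
  refine le_trans ?_ (hgood _)
  linarith
end
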